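/- arXiv:2312.03287 — 2 statements merged into one kernel-verified Lean document; each statement's English description precedes it below -/
import Mathlib

section
/- For any sufficiently smooth function u on ℝ^{1+2} supported in the cone K and any s ∈ [2,+∞), one has: sup_{(t,x)∈H_s} |s·u(t,x)| ≲ Σ_{|J| ≤ 2} ‖(s/t)L^J u‖_{L²_f(H_s)}, with an implied constant independent of u and s. -/
open MeasureTheory Real Filter Topology
open scoped ENNReal NNReal

noncomputable section

/-- A spacetime point in `ℝ^{1+2}`: coordinates `(x₀, x₁, x₂)` with `t = x₀`. -/
abbrev Pt : Type := Fin 3 → ℝ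

/-- The `i`-th standard basis vector of `ℝ^{1+2}`. -/
def e3 (i : Fin 3) : Pt := Pi.single i 1

/-- Partial derivative `∂_i`. -/
def pd (i : Fin 3) (u : Pt → ℝ) : Pt → ℝ := fun p => fderiv ℝ u p (e3 i)

/-- Spatial radius `r = |x|`. -/
def rad (p : Pt) : ℝ := Real.sqrt ((p 1) ^ 2 + (p 2) ^ 2)

/-- Hyperbolic time `s = √(t² − |x|²)`. -/
def sVar (p : Pt) : ℝ := Real.sqrt ((p 0) ^ 2 - (p 1) ^ 2 - (p 2) ^ 2)

/-- The cone `K = {(t,x) : t ≥ 2, |x| < t − 1}`. -/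
def Cone : Set Pt := {p | 2 ≤ p 0 ∧ rad p < p 0 - 1}

/-- Lorentz boost `L_a = x_a ∂_t + t ∂_a`, `a ∈ {1,2}`. -/
def Lb (a : Fin 2) (u : Pt → ℝ) : Pt → ℝ :=
  fun p => p a.succ * pd 0 u p + p 0 * pd a.succ u p

/-- Semi-hyperboloidal derivative `∂̲_a = (x_a/t)∂_t + ∂_a`. -/
def dund (a : Fin 2) (u : Pt → ℝ) : Pt → ℝ :=
  fun p => (p a.succ / p 0) * pd 0 u p + pd a.succ u p

/-- The ordered family `{Γ_k} = {∂₀, ∂₁, ∂₂, L₁, L₂}`. -/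
def Gam : Fin 5 → (Pt → ℝ) → (Pt → ℝ) := ![pd 0, pd 1, pd 2, Lb 0, Lb 1]

/-- `Γ^I = Π_k Γ_k^{i_k}` for a multi-index `I ∈ ℕ⁵`. -/
def GamI (I : Fin 5 → ℕ) : (Pt → ℝ) → (Pt → ℝ) :=
  (Gam 0)^[I 0] ∘ (Gam 1)^[I 1] ∘ (Gam 2)^[I 2] ∘ (Gam 3)^[I 3] ∘ (Gam 4)^[I 4]

/-- Length `|I|` of a multi-index. -/
def mlen (I : Fin 5 → ℕ) : ℕ := ∑ k, I k

/-- The (finite) set of multi-indices `I ∈ ℕ⁵` with `|I| ≤ n`. -/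
def midxLe (n : ℕ) : Finset (Fin 5 → ℕ) :=
  (Fintype.piFinset fun _ => Finset.range (n + 1)).filter fun I => mlen I ≤ n

/-- The (finite) set of multi-indices `I ∈ ℕ⁵` with `|I| = 1`. -/
def midxEq1 : Finset (Fin 5 → ℕ) :=
  (Fintype.piFinset fun _ => Finset.range 2).filter fun I => mlen I = 1

/-- `|∂u| = (Σ_α |∂_α u|²)^{1/2}`. -/
def pdNorm (u : Pt → ℝ) (p : Pt) : ℝ := Real.sqrt (∑ α, (pd α u p) ^ 2)

/-- The wave operator `□ = −∂_t² + ∂₁² + ∂₂²`. -/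
def box (u : Pt → ℝ) : Pt → ℝ :=
  fun p => - pd 0 (pd 0 u) p + pd 1 (pd 1 u) p + pd 2 (pd 2 u) p

/-- The null condition for constants `P^{γαβ}`. -/
def NullCond (P : Fin 3 → Fin 3 → Fin 3 → ℝ) : Prop :=
  ∀ ξ : Fin 3 → ℝ, ξ 0 ^ 2 = ξ 1 ^ 2 + ξ 2 ^ 2 →
    ∑ γ, ∑ α, ∑ β, P γ α β * ξ γ * ξ α * ξ β = 0

/-- The symmetry condition `P^{γαβ} = P^{γβα}`. -/
def SymmCond (P : Fin 3 → Fin 3 → Fin 3 → ℝ) : Prop := ∀ γ α β, P γ α β = P γ β α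

/-- Null form `N(w,z) = P^{γαβ} ∂_γ w ∂_α∂_β z`. -/
def Nform (P : Fin 3 → Fin 3 → Fin 3 → ℝ) (w z : Pt → ℝ) : Pt → ℝ :=
  fun p => ∑ γ, ∑ α, ∑ β, P γ α β * pd γ w p * pd α (pd β z) p

/-- The point of the hyperboloid `H_s` above `x ∈ ℝ²`. -/
def hypPt (s : ℝ) (x : Fin 2 → ℝ) : Pt :=
  ![Real.sqrt (s ^ 2 + (x 0) ^ 2 + (x 1) ^ 2), x 0, x 1]

/-- `‖u‖_{L²_f(H_s)}`. -/
def L2H (u : Pt → ℝ) (s : ℝ) : ℝ :=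
  (∫ x : Fin 2 → ℝ, (u (hypPt s x)) ^ 2) ^ (1 / 2 : ℝ)

/-- The hyperboloidal energy `E_m(u,s)`. -/
def Em (m : ℝ) (u : Pt → ℝ) (s : ℝ) : ℝ :=
  ∫ x : Fin 2 → ℝ,
    (((s / hypPt s x 0) * pd 0 u (hypPt s x)) ^ 2
      + ∑ a : Fin 2, (dund a u (hypPt s x)) ^ 2
      + m ^ 2 * (u (hypPt s x)) ^ 2)

/-- `K₀ = s∂_s + 2x^a∂̲_a`, where `s∂_s = (s²/t)∂_t`. -/
def K0op (u : Pt → ℝ) : Pt → ℝ :=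
  fun p => (sVar p) ^ 2 / p 0 * pd 0 u p + 2 * ∑ a : Fin 2, p a.succ * dund a u p

/-- The conformal energy `E_con(u,s)`. -/
def Econ (u : Pt → ℝ) (s : ℝ) : ℝ :=
  ∫ x : Fin 2 → ℝ,
    ((K0op u (hypPt s x) + u (hypPt s x)) ^ 2
      + ∑ a : Fin 2, (s * dund a u (hypPt s x)) ^ 2)


/-- `L^J = L₁^{j₁} L₂^{j₂}` for a multi-index `J ∈ ℕ²`. -/
def LK (J : Fin 2 → ℕ) : (Pt → ℝ) → (Pt → ℝ) := (Lb 0)^[J 0] ∘ (Lb 1)^[J 1]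

/-- The (finite) set of multi-indices `J ∈ ℕ²` with `|J| ≤ n`. -/
def midx2Le (n : ℕ) : Finset (Fin 2 → ℕ) :=
  (Fintype.piFinset fun _ => Finset.range (n + 1)).filter fun J => J 0 + J 1 ≤ n

theorem Lb_contDiff (a : Fin 2) {u : Pt → ℝ} (hu : ContDiff ℝ (⊤ : ℕ∞) u) :
    ContDiff ℝ (⊤ : ℕ∞) (Lb a u) := by
  have h : ∀ i, ContDiff ℝ (⊤ : ℕ∞) (pd i u) := fun i =>
    (hu.fderiv_right (m := (⊤ : ℕ∞)) (by norm_cast)).clm_apply contDiff_const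
  have hc : ∀ i, ContDiff ℝ (⊤ : ℕ∞) (fun p : Pt => p i) := fun i => contDiff_apply ℝ ℝ i
  exact ((hc _).mul (h 0)).add ((hc 0).mul (h _))

theorem tsupport_Lb_subset (a : Fin 2) (u : Pt → ℝ) : tsupport (Lb a u) ⊆ tsupport u := by
  refine closure_minimal (fun p hp => ?_) (isClosed_tsupport u)
  by_contra h
  have h0 : fderiv ℝ u p = 0 := by
    by_contra h1
    exact h (support_fderiv_subset ℝ h1)
  exact hp (by simp [Lb, pd, h0])

theorem hypPt_zero_pos {s : ℝ} (hs : 2 ≤ s) (x : Fin 2 → ℝ) : 0 < hypPt s x 0 := by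
  simp only [hypPt, Matrix.cons_val_zero]
  positivity

theorem hypPt_zero_sq (s : ℝ) (x : Fin 2 → ℝ) :
    hypPt s x 0 ^ 2 = s ^ 2 + x 0 ^ 2 + x 1 ^ 2 := by
  simp only [hypPt, Matrix.cons_val_zero]
  exact Real.sq_sqrt (by positivity)

theorem continuous_hypPt (s : ℝ) : Continuous (hypPt s) := by
  refine continuous_pi fun i => ?_
  fin_cases i <;> simp [hypPt] <;> fun_prop

theorem hasDerivAt_hypPt_zero {s : ℝ} (hs : 2 ≤ s) (x : Fin 2 → ℝ) (i : Fin 2) :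
    HasDerivAt (fun c => hypPt s (Function.update x i c) 0) (x i / hypPt s x 0) (x i) := by
  have hx := (hypPt_zero_pos hs x).ne'
  have hne : s ^ 2 + x 0 ^ 2 + x 1 ^ 2 ≠ 0 := by positivity
  revert i
  rw [Fin.forall_fin_two]
  constructor
  · have h : HasDerivAt (fun c : ℝ => s ^ 2 + c ^ 2 + x 1 ^ 2) (2 * x 0) (x 0) := by
      simpa using ((hasDerivAt_pow 2 (x 0)).const_add (s ^ 2)).add_const (x 1 ^ 2)
    simpa [hypPt, mul_div_mul_left] using h.sqrt hne
  · have h : HasDerivAt (fun c : ℝ => s ^ 2 + x 0 ^ 2 + c ^ 2) (2 * x 1) (x 1) := by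
      simpa using (hasDerivAt_pow 2 (x 1)).const_add (s ^ 2 + x 0 ^ 2)
    simpa [hypPt, mul_div_mul_left] using h.sqrt hne

/-- Along the hyperboloid, `t` times the coordinate derivative is the boost. -/
theorem hasDerivAt_comp_hypPt {f : Pt → ℝ} (hf : ContDiff ℝ (⊤ : ℕ∞) f) {s : ℝ} (hs : 2 ≤ s)
    (x : Fin 2 → ℝ) (i : Fin 2) :
    HasDerivAt (fun c => f (hypPt s (Function.update x i c)))
      (Lb i f (hypPt s x) / hypPt s x 0) (x i) := by
  have hx := (hypPt_zero_pos hs x).ne'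
  have hγ : HasDerivAt (fun c => hypPt s (Function.update x i c))
      ((x i / hypPt s x 0) • e3 0 + e3 i.succ) (x i) := by
    rw [hasDerivAt_pi]
    intro j
    have h0 := hasDerivAt_hypPt_zero hs x i
    induction j using Fin.cases with
    | zero => simpa [e3] using h0
    | succ k =>
      have h1 := (hasDerivAt_pi.1 (hasDerivAt_update x i (x i))) k
      have h2 : ∀ y : Fin 2 → ℝ, hypPt s y k.succ = y k := by
        intro y; fin_cases k <;> simp [hypPt]
      simp only [h2]
      convert h1 using 1
      simp [e3, Pi.single_apply]
  have hfd : HasFDerivAt f (fderiv ℝ f (hypPt s x)) (hypPt s (Function.update x i (x i))) := by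
    rw [Function.update_eq_self]
    exact (hf.differentiable (by simp) _).hasFDerivAt
  refine (hfd.comp_hasDerivAt (x i) hγ).congr_deriv ?_
  have hk : hypPt s x i.succ = x i := by fin_cases i <;> simp [hypPt]
  simp only [Lb, pd, hk, map_add, map_smul, smul_eq_mul]
  field_simp

theorem abs_apply_le_of_hypPt_mem_tsupport {u : Pt → ℝ} (hu : Function.support u ⊆ Cone) {s : ℝ}
    {x : Fin 2 → ℝ} (hx : hypPt s x ∈ tsupport u) (i : Fin 2) : |x i| ≤ s ^ 2 := by
  have hcl : IsClosed ({p : Pt | 2 ≤ p 0 ∧ rad p ≤ p 0 - 1} : Set Pt) := by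
    have h0 : Continuous fun p : Pt => p 0 := continuous_apply 0
    have hr : Continuous rad := by unfold rad; fun_prop
    exact (isClosed_le continuous_const h0).inter (isClosed_le hr (h0.sub continuous_const))
  have hsub : Function.support u ⊆ {p : Pt | 2 ≤ p 0 ∧ rad p ≤ p 0 - 1} :=
    fun p hp => ⟨(hu hp).1, (hu hp).2.le⟩
  have h := closure_minimal hsub hcl hx
  have h2 := h.2
  have ht := hypPt_zero_sq s x
  set t := hypPt s x 0
  have hr : rad (hypPt s x) = √(x 0 ^ 2 + x 1 ^ 2) := by simp [rad, hypPt]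
  have hsq : √(x 0 ^ 2 + x 1 ^ 2) ^ 2 = x 0 ^ 2 + x 1 ^ 2 := Real.sq_sqrt (by positivity)
  rw [hr] at h2
  have hi : |x i| ≤ √(x 0 ^ 2 + x 1 ^ 2) := by
    apply Real.abs_le_sqrt
    fin_cases i <;> simp <;> positivity
  have := Real.sqrt_nonneg (x 0 ^ 2 + x 1 ^ 2)
  nlinarith

theorem hasCompactSupport_of_vanish_off_tsupport {u : Pt → ℝ} (hu : Function.support u ⊆ Cone)
    {s : ℝ} {g : (Fin 2 → ℝ) → ℝ} (hg : ∀ x, hypPt s x ∉ tsupport u → g x = 0) :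
    HasCompactSupport g := by
  refine HasCompactSupport.intro (isCompact_closedBall 0 (s ^ 2)) fun x hx => hg x fun h => hx ?_
  rw [mem_closedBall_zero_iff, pi_norm_le_iff_of_nonneg (by positivity)]
  exact fun i => abs_apply_le_of_hypPt_mem_tsupport hu h i

theorem abs_le_integral_abs_deriv {f f' : ℝ → ℝ} (hf : ∀ x, HasDerivAt f (f' x) x)
    (hf' : Continuous f') (hc : HasCompactSupport f) (b : ℝ) : |f b| ≤ ∫ x, |f' x| := by
  have hd : deriv f = f' := funext fun x => (hf x).deriv
  have hC : ContDiff ℝ 1 f :=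
    contDiff_one_iff_deriv.2 ⟨fun x => (hf x).differentiableAt, hd ▸ hf'⟩
  have hi : Integrable f' := hf'.integrable_of_hasCompactSupport (hd ▸ hc.deriv)
  rw [← hc.integral_Iic_deriv_eq hC b, hd]
  exact (abs_integral_le_integral_abs).trans
    (setIntegral_le_integral hi.abs (Eventually.of_forall fun _ => abs_nonneg _))

theorem abs_le_integral_abs_mixed_deriv {G H K : (Fin 2 → ℝ) → ℝ}
    (hG : ∀ x, HasDerivAt (fun c => G (Function.update x 1 c)) (H x) (x 1))
    (hH : ∀ x, HasDerivAt (fun c => H (Function.update x 0 c)) (K x) (x 0))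
    (hHc : Continuous H) (hKc : Continuous K) (hGs : HasCompactSupport G)
    (hHs : HasCompactSupport H) (hKs : HasCompactSupport K) (x : Fin 2 → ℝ) :
    |G x| ≤ ∫ y, |K y| := by
  have hu1 : ∀ a b c : ℝ, Function.update ![a, b] 1 c = ![a, c] := by
    intro a b c; ext j; fin_cases j <;> simp
  have hu0 : ∀ a b c : ℝ, Function.update ![a, b] 0 c = ![c, b] := by
    intro a b c; ext j; fin_cases j <;> simp
  have hc1 : ∀ a : ℝ, Continuous fun b : ℝ => ![a, b] := fun a => by fun_prop
  have hc0 : ∀ b : ℝ, Continuous fun a : ℝ => ![a, b] := fun b => by fun_prop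
  have hcs : ∀ {F : (Fin 2 → ℝ) → ℝ}, HasCompactSupport F → ∀ a : ℝ,
      HasCompactSupport (fun b => F ![a, b]) ∧ HasCompactSupport (fun b => F ![b, a]) := by
    intro F hF a
    obtain ⟨R, hR⟩ := hF.isCompact.isBounded.subset_closedBall 0
    have key : ∀ y : Fin 2 → ℝ, ∀ i, R < |y i| → F y = 0 := by
      intro y i hy
      by_contra h
      have := hR (subset_tsupport F h)
      rw [mem_closedBall_zero_iff] at this
      exact absurd ((norm_le_pi_norm y i).trans this) (by simpa using hy)
    constructor
    · refine HasCompactSupport.intro (isCompact_closedBall 0 R) fun b hb => key _ 1 ?_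
      simpa using hb
    · refine HasCompactSupport.intro (isCompact_closedBall 0 R) fun b hb => key _ 0 ?_
      simpa using hb
  have hint : Integrable (fun y => |K y|) :=
    (hKc.integrable_of_hasCompactSupport hKs).abs
  have hmp := (volume_preserving_finTwoArrow ℝ).symm
  have hcomp : Integrable (fun p : ℝ × ℝ => |K ![p.1, p.2]|) (volume.prod volume) :=
    hmp.integrable_comp_of_integrable hint
  have heq : ∫ y, |K y| = ∫ b, ∫ a, |K ![a, b]| := by
    rw [← integral_prod_symm _ hcomp]
    exact (hmp.integral_comp' (fun y => |K y|)).symm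
  have hx : x = ![x 0, x 1] := by ext j; fin_cases j <;> rfl
  have hG' : ∀ b, HasDerivAt (fun c => G ![x 0, c]) (H ![x 0, b]) b := fun b => by
    simpa [hu1] using hG ![x 0, b]
  have hH' : ∀ b a, HasDerivAt (fun c => H ![c, b]) (K ![a, b]) a := fun b a => by
    simpa [hu0] using hH ![a, b]
  calc |G x| = |G ![x 0, x 1]| := by rw [← hx]
    _ ≤ ∫ b, |H ![x 0, b]| :=
        abs_le_integral_abs_deriv hG' (hHc.comp (hc1 _)) (hcs hGs _).1 (x 1)
    _ ≤ ∫ b, ∫ a, |K ![a, b]| := by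
        refine integral_mono ?_ hcomp.integral_prod_right fun b => ?_
        · exact ((hHc.comp (hc1 _)).integrable_of_hasCompactSupport (hcs hHs _).1).abs
        · exact abs_le_integral_abs_deriv (hH' b) (hKc.comp (hc0 _)) (hcs hHs _).2 (x 0)
    _ = ∫ y, |K y| := heq.symm

theorem L2H_sq (u : Pt → ℝ) (s : ℝ) : L2H u s ^ 2 = ∫ x : Fin 2 → ℝ, u (hypPt s x) ^ 2 := by
  rw [L2H, ← Real.sqrt_eq_rpow]
  exact Real.sq_sqrt (integral_nonneg fun _ => sq_nonneg _)

theorem L2H_nonneg (u : Pt → ℝ) (s : ℝ) : 0 ≤ L2H u s :=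
  Real.rpow_nonneg (integral_nonneg fun _ => sq_nonneg _) _

theorem sq_mul_le_L2H {u : Pt → ℝ} (hu : ContDiff ℝ (⊤ : ℕ∞) u)
    (hsupp : Function.support u ⊆ Cone) {s : ℝ} (hs : 2 ≤ s) (x : Fin 2 → ℝ) :
    (s * u (hypPt s x)) ^ 2 ≤
      2 * L2H (fun p => (s / p 0) * u p) s ^ 2 + L2H (fun p => (s / p 0) * Lb 0 u p) s ^ 2
      + 2 * L2H (fun p => (s / p 0) * Lb 1 u p) s ^ 2
      + L2H (fun p => (s / p 0) * Lb 0 (Lb 1 u) p) s ^ 2 := by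
  have h0 := Lb_contDiff 0 hu
  have h1 := Lb_contDiff 1 hu
  have h01 := Lb_contDiff 0 h1
  have hpos := hypPt_zero_pos hs
  have hne : ∀ y, hypPt s y 0 ≠ 0 := fun y => (hpos y).ne'
  have hct : Continuous fun y => hypPt s y 0 := (continuous_apply 0).comp (continuous_hypPt s)
  have hcc : ∀ {f : Pt → ℝ}, ContDiff ℝ (⊤ : ℕ∞) f → Continuous fun y => f (hypPt s y) :=
    fun hf => hf.continuous.comp (continuous_hypPt s)
  have hcu := hcc hu
  have hc0 := hcc h0
  have hc1 := hcc h1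
  have hc01 := hcc h01
  have van : ∀ {f : Pt → ℝ}, tsupport f ⊆ tsupport u → ∀ y, hypPt s y ∉ tsupport u →
      f (hypPt s y) = 0 := fun hf y hy => image_eq_zero_of_notMem_tsupport fun h => hy (hf h)
  have v0 := van (tsupport_Lb_subset 0 u)
  have v1 := van (tsupport_Lb_subset 1 u)
  have v01 := van ((tsupport_Lb_subset 0 (Lb 1 u)).trans (tsupport_Lb_subset 1 u))
  have vu := van (subset_refl (tsupport u))
  have hint : ∀ {f : Pt → ℝ}, ContDiff ℝ (⊤ : ℕ∞) f →
      (∀ y, hypPt s y ∉ tsupport u → f (hypPt s y) = 0) →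
      Integrable fun y : Fin 2 → ℝ => (s / hypPt s y 0 * f (hypPt s y)) ^ 2 := by
    intro f hf hv
    refine Continuous.integrable_of_hasCompactSupport ?_
      (hasCompactSupport_of_vanish_off_tsupport (s := s) hsupp fun y hy => by simp [hv y hy])
    exact ((continuous_const.div hct hne).mul (hcc hf)).pow 2
  let G : (Fin 2 → ℝ) → ℝ := fun y => u (hypPt s y) ^ 2
  let H : (Fin 2 → ℝ) → ℝ := fun y => 2 * u (hypPt s y) * (Lb 1 u (hypPt s y) / hypPt s y 0)
  let K : (Fin 2 → ℝ) → ℝ := fun y =>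
    2 * (Lb 0 u (hypPt s y) / hypPt s y 0) * (Lb 1 u (hypPt s y) / hypPt s y 0)
    + 2 * u (hypPt s y) * ((Lb 0 (Lb 1 u) (hypPt s y) / hypPt s y 0 * hypPt s y 0
      - Lb 1 u (hypPt s y) * (y 0 / hypPt s y 0)) / hypPt s y 0 ^ 2)
  have hKc : Continuous K := by
    have hne2 : ∀ y, hypPt s y 0 ^ 2 ≠ 0 := fun y => pow_ne_zero 2 (hne y)
    exact ((continuous_const.mul (hc0.div hct hne)).mul (hc1.div hct hne)).add
      ((continuous_const.mul hcu).mul ((((hc01.div hct hne).mul hct).sub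
        (hc1.mul ((continuous_apply 0).div hct hne))).div (hct.pow 2) hne2))
  have hHc : Continuous H := (continuous_const.mul hcu).mul (hc1.div hct hne)
  have hG : ∀ y, HasDerivAt (fun c => G (Function.update y 1 c)) (H y) (y 1) := fun y => by
    have := (hasDerivAt_comp_hypPt hu hs y 1).fun_pow 2
    simpa [G, H] using this
  have hH : ∀ y, HasDerivAt (fun c => H (Function.update y 0 c)) (K y) (y 0) := fun y => by
    have := ((hasDerivAt_comp_hypPt hu hs y 0).const_mul 2).mul
      ((hasDerivAt_comp_hypPt h1 hs y 0).div (hasDerivAt_hypPt_zero hs y 0) (by simpa using hne y))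
    simp only [Function.update_eq_self] at this
    exact this
  have hGs : HasCompactSupport G :=
    hasCompactSupport_of_vanish_off_tsupport (s := s) hsupp fun y hy => by simp [G, vu y hy]
  have hHs : HasCompactSupport H :=
    hasCompactSupport_of_vanish_off_tsupport (s := s) hsupp fun y hy => by simp [H, vu y hy]
  have hKs : HasCompactSupport K :=
    hasCompactSupport_of_vanish_off_tsupport (s := s) hsupp fun y hy => by simp [K, v0 y hy, vu y hy]
  have hmain := abs_le_integral_abs_mixed_deriv hG hH hHc hKc hGs hHs hKs x
  have iu := hint hu vu
  have i0 := hint h0 v0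
  have i1 := hint h1 v1
  have i01 := hint h01 v01
  have hpt : ∀ y, s ^ 2 * |K y| ≤ 2 * (s / hypPt s y 0 * u (hypPt s y)) ^ 2
      + (s / hypPt s y 0 * Lb 0 u (hypPt s y)) ^ 2
      + 2 * (s / hypPt s y 0 * Lb 1 u (hypPt s y)) ^ 2
      + (s / hypPt s y 0 * Lb 0 (Lb 1 u) (hypPt s y)) ^ 2 := by
    intro y
    have hy : |y 0 / hypPt s y 0| ≤ 1 := by
      rw [abs_div, abs_of_pos (hpos y), div_le_one (hpos y)]
      refine abs_le_of_sq_le_sq ?_ (hpos y).le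
      rw [hypPt_zero_sq]
      nlinarith [sq_nonneg s, sq_nonneg (y 1)]
    have hKy : K y * s ^ 2 = 2 * (s / hypPt s y 0 * Lb 0 u (hypPt s y))
          * (s / hypPt s y 0 * Lb 1 u (hypPt s y))
        + 2 * (s / hypPt s y 0 * u (hypPt s y))
          * (s / hypPt s y 0 * Lb 0 (Lb 1 u) (hypPt s y)
            - s / hypPt s y 0 * Lb 1 u (hypPt s y) * (y 0 / hypPt s y 0)) := by
      have := hne y
      simp only [K]
      field_simp
    rw [mul_comm, ← abs_of_nonneg (sq_nonneg s), ← abs_mul, hKy]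
    generalize s / hypPt s y 0 * Lb 0 u (hypPt s y) = A
    generalize s / hypPt s y 0 * Lb 0 (Lb 1 u) (hypPt s y) = D
    generalize s / hypPt s y 0 * Lb 1 u (hypPt s y) = B
    generalize s / hypPt s y 0 * u (hypPt s y) = V
    generalize y 0 / hypPt s y 0 = q at hy
    have hq : (B * q) ^ 2 ≤ B ^ 2 := by
      rw [mul_pow]
      exact mul_le_of_le_one_right (sq_nonneg B) ((sq_le_one_iff_abs_le_one q).2 hy)
    rw [abs_le]
    constructor <;>
    nlinarith [sq_nonneg (A - B), sq_nonneg (A + B), sq_nonneg (V - D), sq_nonneg (V + D),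
      sq_nonneg (V - B * q), sq_nonneg (V + B * q)]
  have hG0 : |G x| = u (hypPt s x) ^ 2 := abs_of_nonneg (sq_nonneg _)
  simp only [L2H_sq]
  calc (s * u (hypPt s x)) ^ 2 = s ^ 2 * |G x| := by rw [hG0]; ring
    _ ≤ s ^ 2 * ∫ y, |K y| := by gcongr
    _ = ∫ y, s ^ 2 * |K y| := (integral_const_mul _ _).symm
    _ ≤ _ := integral_mono ((hKc.integrable_of_hasCompactSupport hKs).abs.const_mul _)
        ((((iu.const_mul 2).add i0).add (i1.const_mul 2)).add i01) hpt
    _ = _ := by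
      rw [integral_add' (((iu.const_mul 2).add i0).add (i1.const_mul 2)) i01,
        integral_add' ((iu.const_mul 2).add i0) (i1.const_mul 2),
        integral_add' (iu.const_mul 2) i0, integral_const_mul,
        integral_const_mul]

/-- Klainerman–Sobolev inequality on hyperboloids (`s`-weighted version). -/
theorem klainerman_sobolev_s :
    ∃ C > (0:ℝ), ∀ u : Pt → ℝ,
      ContDiff ℝ (⊤ : ℕ∞) u → Function.support u ⊆ Cone →
      ∀ s : ℝ, 2 ≤ s → ∀ x : Fin 2 → ℝ,
        |s * u (hypPt s x)| ≤
          C * ∑ J ∈ midx2Le 2, L2H (fun p => (s / p 0) * LK J u p) s := by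
  refine ⟨3, by norm_num, fun u hu hsupp s hs x => ?_⟩
  set S := ∑ J ∈ midx2Le 2, L2H (fun p => (s / p 0) * LK J u p) s
  have hle : ∀ J ∈ midx2Le 2, L2H (fun p => (s / p 0) * LK J u p) s ^ 2 ≤ S ^ 2 := fun J hJ =>
    pow_le_pow_left₀ (L2H_nonneg _ _)
      (Finset.single_le_sum (f := fun J => L2H (fun p => (s / p 0) * LK J u p) s)
        (fun _ _ => L2H_nonneg _ _) hJ) 2
  have h00 := hle ![0, 0] (by decide)
  have h10 := hle ![1, 0] (by decide)
  have h01 := hle ![0, 1] (by decide)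
  have h11 := hle ![1, 1] (by decide)
  simp only [LK, Matrix.cons_val_zero, Matrix.cons_val_one, Function.iterate_zero,
    Function.iterate_one, Function.comp_apply, id_eq] at h00 h10 h01 h11
  have hS : 0 ≤ S := Finset.sum_nonneg fun _ _ => L2H_nonneg _ _
  refine abs_le_of_sq_le_sq ?_ (by positivity)
  nlinarith [sq_mul_le_L2H hu hsupp hs x, sq_nonneg S]
end
end

section
/- For any sufficiently smooth function w on the region {(t,x) ∈ ℝ^{1+2} : t > 0}, the d'Alembert operator admits the decomposition (with r = |x| and Einstein summation over a = 1,2): -□w = ((t−r)(t+r)/t²) ∂_t∂_t w + (x^a/t²) ∂_t L_a w − (1/t) ∂^a L_a w + (2/t) ∂_t w − (x^a/t²) ∂_a w. -/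
open MeasureTheory Real Filter Topology
open scoped ENNReal NNReal

noncomputable section

lemma differentiableAt_pd {w : Pt → ℝ} {p : Pt} (hw : ContDiffAt ℝ 2 w p) (i : Fin 3) :
    DifferentiableAt ℝ (pd i w) p := by
  have h : DifferentiableAt ℝ (fderiv ℝ w) p :=
    (hw.fderiv_right (m := 1) (by norm_num)).differentiableAt (by norm_num)
  exact h.clm_apply (differentiableAt_const _)

/-- Second partial derivatives of a `C²` function commute. -/
lemma pd_comm {w : Pt → ℝ} {p : Pt} (hw : ContDiffAt ℝ 2 w p) (i j : Fin 3) :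
    pd i (pd j w) p = pd j (pd i w) p := by
  have h : DifferentiableAt ℝ (fderiv ℝ w) p :=
    (hw.fderiv_right (m := 1) (by norm_num)).differentiableAt (by norm_num)
  have key (k l : Fin 3) : pd k (pd l w) p = fderiv ℝ (fderiv ℝ w) p (e3 k) (e3 l) := by
    change fderiv ℝ (fun q => fderiv ℝ w q (e3 l)) p (e3 k) = _
    rw [fderiv_clm_apply h (differentiableAt_const _)]
    simp
  rw [key, key]
  exact (hw.isSymmSndFDerivAt (by simp)).eq _ _

lemma pd_mul {f g : Pt → ℝ} {p : Pt} (hf : DifferentiableAt ℝ f p) (hg : DifferentiableAt ℝ g p)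
    (i : Fin 3) : pd i (fun q => f q * g q) p = pd i f p * g p + f p * pd i g p := by
  simp only [pd, fderiv_fun_mul hf hg, add_apply, smul_apply, smul_eq_mul]
  ring

lemma pd_coord (i j : Fin 3) (p : Pt) : pd i (fun q => q j) p = if j = i then 1 else 0 := by
  have h : HasFDerivAt (fun q : Pt => q j) (ContinuousLinearMap.proj (R := ℝ) j) p :=
    (ContinuousLinearMap.proj (R := ℝ) (φ := fun _ : Fin 3 => ℝ) j).hasFDerivAt
  simp [pd, h.fderiv, e3, Pi.single_apply]

/-- Product rule for a partial derivative of a Lorentz boost. -/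
lemma pd_Lb {w : Pt → ℝ} {p : Pt} (hw : ContDiffAt ℝ 2 w p) (i : Fin 3) (a : Fin 2) :
    pd i (Lb a w) p =
      (if a.succ = i then 1 else 0) * pd 0 w p + p a.succ * pd i (pd 0 w) p
        + ((if 0 = i then 1 else 0) * pd a.succ w p + p 0 * pd i (pd a.succ w) p) := by
  have hc (j : Fin 3) : DifferentiableAt ℝ (fun q : Pt => q j) p := by fun_prop
  have hd := differentiableAt_pd hw
  rw [← pd_coord i a.succ p, ← pd_coord i 0 p, ← pd_mul (hc _) (hd _), ← pd_mul (hc _) (hd _)]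
  have hm (j k : Fin 3) : DifferentiableAt ℝ (fun q : Pt => q j * pd k w q) p :=
    (hc j).mul (hd k)
  exact congrArg (fun T => T (e3 i)) (fderiv_fun_add (hm a.succ 0) (hm 0 a.succ))

/-- decomposition of the d'Alembert operator in the region `t > 0`. -/
theorem dalembert_decomposition (w : Pt → ℝ)
    (hw : ContDiffOn ℝ (⊤ : ℕ∞) w {p : Pt | 0 < p 0}) :
    ∀ p : Pt, 0 < p 0 →
      - box w p =
        ((p 0 - rad p) * (p 0 + rad p) / (p 0) ^ 2) * pd 0 (pd 0 w) p
          + (∑ a : Fin 2, (p a.succ / (p 0) ^ 2) * pd 0 (Lb a w) p)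
          - (∑ a : Fin 2, (1 / p 0) * pd a.succ (Lb a w) p)
          + (2 / p 0) * pd 0 w p
          - ∑ a : Fin 2, (p a.succ / (p 0) ^ 2) * pd a.succ w p := by
  intro p hp
  have hopen : IsOpen {p : Pt | 0 < p 0} := isOpen_lt continuous_const (continuous_apply 0)
  have hw2 : ContDiffAt ℝ 2 w p :=
    (hw.contDiffAt (hopen.mem_nhds hp)).of_le (by norm_cast)
  have hr : (p 0 - rad p) * (p 0 + rad p) = p 0 ^ 2 - (p 1 ^ 2 + p 2 ^ 2) := by
    have h : rad p ^ 2 = p 1 ^ 2 + p 2 ^ 2 := Real.sq_sqrt (by positivity)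
    rw [← h]
    ring
  have hp0 : p 0 ≠ 0 := hp.ne'
  simp only [hr, pd_Lb hw2, Fin.sum_univ_two, box, Fin.succ_zero_eq_one, Fin.succ_one_eq_two,
    pd_comm hw2 1 0, pd_comm hw2 2 0]
  simp
  field_simp
  ring
end
end
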